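/- Let a : G → ℤ₂ be a group homomorphism, b ∈ C¹(G,ℤ₂⊕ℤ₂), and κ ∈ C²(G,ℤ₂⊕ℤ₂) with d²ₐκ = 0. Define x ∈ C³(G,U(1)⊕U(1)) by x(g,h,k) := (−1)^{b(g)·κ(h,k)^{a(g)}}. Then for all g, h, k, f ∈ G one has (d³ₐx)(g,h,k,f) = (−1)^{(d¹ₐb)(g,h)·κ(k,f)^{a(gh)}}. -/

import Mathlib

noncomputable section

/-- `ℤ₂ ⊕ ℤ₂`, written additively with componentwise addition. -/
abbrev Z22 := ZMod 2 × ZMod 2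

/-- `U(1) ⊕ U(1)`, written multiplicatively with componentwise multiplication,
where `U(1)` is the circle group. -/
abbrev U12 := Circle × Circle

/-- The `ℤ₂`-action on `ℤ₂ ⊕ ℤ₂`: `x^n = x` if `n = 0` and the swap of the two
components if `n = 1`. -/
def actZ (n : ZMod 2) (x : Z22) : Z22 := if n = 0 then x else (x.2, x.1)

/-- The `ℤ₂`-action on `U(1) ⊕ U(1)`: `x^n = x` if `n = 0` and the swap of the two
components if `n = 1`. -/
def actU (n : ZMod 2) (x : U12) : U12 := if n = 0 then x else (x.2, x.1)

/-- The componentwise product `x·y` in the field `ℤ₂`. -/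
def dotZ (x y : Z22) : Z22 := (x.1 * y.1, x.2 * y.2)

/-- `-1` as an element of the circle group. -/
def negOneC : Circle := ⟨-1, by simp [Submonoid.unitSphere]⟩

/-- `(−1)^x ∈ U(1) ⊕ U(1)` for `x ∈ ℤ₂ ⊕ ℤ₂`, componentwise. -/
def negPow (x : Z22) : U12 := (negOneC ^ x.1.val, negOneC ^ x.2.val)

variable {G : Type*} [Group G]

/-- First twisted coboundary, for `ℤ₂ ⊕ ℤ₂`-valued cochains. -/
def d1Z (a : G → ZMod 2) (x : G → Z22) (g h : G) : Z22 :=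
  actZ (a g) (x h) + x g - x (g * h)

/-- Second twisted coboundary, for `ℤ₂ ⊕ ℤ₂`-valued cochains. -/
def d2Z (a : G → ZMod 2) (y : G → G → Z22) (g h k : G) : Z22 :=
  actZ (a g) (y h k) + y g (h * k) - y (g * h) k - y g h

/-- Second twisted coboundary, for `U(1) ⊕ U(1)`-valued cochains. -/
def d2U (a : G → ZMod 2) (y : G → G → U12) (g h k : G) : U12 :=
  actU (a g) (y h k) * y g (h * k) * (y (g * h) k)⁻¹ * (y g h)⁻¹

/-- Third twisted coboundary, for `U(1) ⊕ U(1)`-valued cochains. -/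
def d3U (a : G → ZMod 2) (z : G → G → G → U12) (g h k f : G) : U12 :=
  actU (a g) (z h k f) * z g (h * k) f * z g h k *
    (z (g * h) k f)⁻¹ * (z g h (k * f))⁻¹

lemma negOneC_pow_val_add (m n : ZMod 2) :
    negOneC ^ (m + n).val = negOneC ^ m.val * negOneC ^ n.val := by
  have hsq : negOneC ^ 2 = 1 := by
    ext
    rw [Circle.coe_pow]
    exact neg_one_sq
  rw [← pow_add, ZMod.val_add]
  exact (pow_eq_pow_mod _ hsq).symm

lemma negPow_add (x y : Z22) : negPow (x + y) = negPow x * negPow y :=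
  Prod.ext (negOneC_pow_val_add _ _) (negOneC_pow_val_add _ _)

lemma negPow_neg (x : Z22) : negPow (-x) = (negPow x)⁻¹ :=
  eq_inv_of_mul_eq_one_left <| by rw [← negPow_add, neg_add_cancel]; simp [negPow]

lemma actU_negPow (n : ZMod 2) (x : Z22) : actU n (negPow x) = negPow (actZ n x) := by
  unfold actU actZ
  split_ifs <;> rfl

lemma actZ_add (n : ZMod 2) (x y : Z22) : actZ n (x + y) = actZ n x + actZ n y := by
  unfold actZ
  split_ifs <;> rfl

lemma actZ_neg (n : ZMod 2) (x : Z22) : actZ n (-x) = -actZ n x := by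
  unfold actZ
  split_ifs <;> rfl

lemma actZ_dotZ (n : ZMod 2) (x y : Z22) :
    actZ n (dotZ x y) = dotZ (actZ n x) (actZ n y) := by
  unfold actZ
  split_ifs <;> rfl

lemma actZ_actZ (m n : ZMod 2) (x : Z22) : actZ m (actZ n x) = actZ (m + n) x := by
  revert m n x
  decide

lemma dotZ_eq_mul (x y : Z22) : dotZ x y = x * y := rfl

/-- **Lemma 2.4 (coboundary of the sign cochain).** For a homomorphism
`a : G → ℤ₂`, `b ∈ C¹(G,ℤ₂⊕ℤ₂)` and `κ ∈ C²(G,ℤ₂⊕ℤ₂)` with `d²ₐκ = 0`, setting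
`x(g,h,k) := (−1)^{b(g)·κ(h,k)^{a(g)}}` one has
`(d³ₐx)(g,h,k,f) = (−1)^{(d¹ₐb)(g,h)·κ(k,f)^{a(gh)}}`. -/
theorem d3U_negPow (a : G → ZMod 2) (ha : ∀ g h, a (g * h) = a g + a h)
    (b : G → Z22) (κ : G → G → Z22)
    (hκ : ∀ g h k, d2Z a κ g h k = 0) (g h k f : G) :
    d3U a (fun g' h' k' => negPow (dotZ (b g') (actZ (a g') (κ h' k')))) g h k f =
      negPow (dotZ (d1Z a b g h) (actZ (a (g * h)) (κ k f))) := by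
  have hcocycle : actZ (a (g * h)) (κ k f) =
      actZ (a g) (κ (h * k) f) + actZ (a g) (κ h k) - actZ (a g) (κ h (k * f)) := by
    have hsum : actZ (a h) (κ k f) = κ (h * k) f + κ h k + -κ h (k * f) := by
      linear_combination (norm := (unfold d2Z; ring)) hκ h k f
    rw [ha, ← actZ_actZ, hsum, actZ_add, actZ_add, actZ_neg, sub_eq_add_neg]
  simp only [d3U, actU_negPow, ← negPow_neg, ← negPow_add]
  rw [actZ_dotZ, actZ_actZ, ← ha]
  simp only [dotZ_eq_mul, d1Z]
  congr 1
  linear_combination -b g * hcocycle
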